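/- arXiv:2408.00130 — 2 statements merged into one kernel-verified Lean document; each statement's English description precedes it below -/
import Mathlib

section
/- (Momentum matrix element between Gaussian wavepackets.) Let D ≥ 1, ε > 0, Γ ∈ ℝ^{D×D} real symmetric positive definite, and j ∈ {1,…,D}. For all phase-space points y = (q_y, p_y) and z = (q_z, p_z) in ℝ^D × ℝ^D, the integral ∫_{ℝ^D} conj(g_y(x)) · (−iε ∂g_z/∂x_j)(x) dx exists and equals (1/2)(p_y + p_z + iΓq_y − iΓq_z)_j · ⟨g_y, g_z⟩, where ∂g_z/∂x_j is the partial derivative of g_z in the j-th coordinate, (·)_j denotes the j-th component of the (complex) vector, and ⟨g_y, g_z⟩ = ∫_{ℝ^D} conj(g_y(x)) g_z(x) dx. -/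
open MeasureTheory Matrix

/-- The Gaussian wavepacket with width matrix `Γ`, semiclassical parameter `ε`,
centered at the phase-space point `z = (q, p)`. -/
noncomputable def gaussian {D : ℕ} (ε : ℝ) (Γ : Matrix (Fin D) (Fin D) ℝ)
    (z : (Fin D → ℝ) × (Fin D → ℝ)) (x : Fin D → ℝ) : ℂ :=
  (((Γ.det / (Real.pi ^ D * ε ^ D)) ^ ((1 : ℝ) / 4) : ℝ) : ℂ) *
    Complex.exp ((↑(-(1 / (2 * ε)) * ((x - z.1) ⬝ᵥ Γ.mulVec (x - z.1))) : ℂ) +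
      Complex.I * (↑((1 / ε) * (z.2 ⬝ᵥ (x - z.1))) : ℂ))

theorem Matrix.PosDef.exists_pos_mul_sum_sq_le {D : ℕ} {Γ : Matrix (Fin D) (Fin D) ℝ}
    (hΓ : Γ.PosDef) :
    ∃ c : ℝ, 0 < c ∧ ∀ u : Fin D → ℝ, c * ∑ i, u i ^ 2 ≤ u ⬝ᵥ Γ *ᵥ u := by
  have hcont : Continuous fun u : Fin D → ℝ => u ⬝ᵥ Γ *ᵥ u := by
    simp only [dotProduct, mulVec]
    fun_prop
  obtain ⟨m, hm, hbound⟩ : ∃ m : ℝ, 0 < m ∧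
      ∀ v ∈ Metric.sphere (0 : Fin D → ℝ) 1, m ≤ v ⬝ᵥ Γ *ᵥ v := by
    rcases (Metric.sphere (0 : Fin D → ℝ) 1).eq_empty_or_nonempty with h | h
    · exact ⟨1, one_pos, by simp [h]⟩
    · obtain ⟨v, hv, hmin⟩ := (isCompact_sphere (0 : Fin D → ℝ) 1).exists_isMinOn h
        hcont.continuousOn
      refine ⟨_, ?_, fun w hw => hmin hw⟩
      have hv0 : v ≠ 0 := ne_zero_of_mem_unit_sphere ⟨v, hv⟩
      simpa using hΓ.dotProduct_mulVec_pos hv0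
  have hD : (0 : ℝ) < D + 1 := by positivity
  refine ⟨m / (D + 1), by positivity, fun u => ?_⟩
  rcases eq_or_ne u 0 with rfl | hu
  · simp
  have hnorm : 0 < ‖u‖ := norm_pos_iff.mpr hu
  have hsphere := hbound (‖u‖⁻¹ • u) (by simp [norm_smul, hnorm.ne'])
  rw [mulVec_smul, smul_dotProduct, dotProduct_smul, smul_eq_mul, smul_eq_mul,
    ← mul_assoc, ← sq, inv_pow, inv_mul_eq_div, le_div_iff₀ (by positivity)] at hsphere
  have hsum : ∑ i, u i ^ 2 ≤ (D + 1) * ‖u‖ ^ 2 := by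
    calc ∑ i, u i ^ 2 ≤ ∑ _i : Fin D, ‖u‖ ^ 2 := by
          refine Finset.sum_le_sum fun i _ => ?_
          rw [← sq_abs]
          exact pow_le_pow_left₀ (abs_nonneg _) (norm_le_pi_norm u i) 2
      _ = D * ‖u‖ ^ 2 := by simp
      _ ≤ (D + 1) * ‖u‖ ^ 2 := by gcongr; linarith
  calc m / (D + 1) * ∑ i, u i ^ 2 ≤ m / (D + 1) * ((D + 1) * ‖u‖ ^ 2) := by gcongr
    _ = m * ‖u‖ ^ 2 := by field_simp
    _ ≤ _ := hsphere

theorem integrable_exp_neg_mul_sum_sq {D : ℕ} {b : ℝ} (hb : 0 < b) :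
    Integrable fun u : Fin D → ℝ => Real.exp (-b * ∑ i, u i ^ 2) := by
  simp_rw [Finset.mul_sum, Real.exp_sum]
  exact Integrable.fintype_prod (f := fun _ : Fin D => fun t : ℝ => Real.exp (-b * t ^ 2))
    fun _ => integrable_exp_neg_mul_sq hb

theorem integrable_coord_mul_exp_neg_mul_sum_sq {D : ℕ} {b : ℝ} (hb : 0 < b) (k : Fin D) :
    Integrable fun u : Fin D → ℝ => u k * Real.exp (-b * ∑ i, u i ^ 2) := by
  have h := Integrable.fintype_prod (μ := fun _ : Fin D => (volume : Measure ℝ))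
    (f := fun i : Fin D => fun t : ℝ => (if i = k then t else 1) * Real.exp (-b * t ^ 2))
    fun i => by
      by_cases hi : i = k
      · simpa [hi] using integrable_mul_exp_neg_mul_sq hb
      · simpa [hi] using integrable_exp_neg_mul_sq hb
  simp_rw [Finset.prod_mul_distrib, ← Real.exp_sum, ← Finset.mul_sum,
    Finset.prod_ite_eq' Finset.univ k, if_pos (Finset.mem_univ k)] at h
  exact h

section Gaussian

variable {D : ℕ} {ε : ℝ} {Γ : Matrix (Fin D) (Fin D) ℝ}

theorem norm_gaussian (z : (Fin D → ℝ) × (Fin D → ℝ)) (x : Fin D → ℝ) :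
    ‖gaussian ε Γ z x‖ = |(Γ.det / (Real.pi ^ D * ε ^ D)) ^ ((1 : ℝ) / 4)| *
      Real.exp (-(1 / (2 * ε)) * ((x - z.1) ⬝ᵥ Γ *ᵥ (x - z.1))) := by
  rw [gaussian, norm_mul, Complex.norm_real, Real.norm_eq_abs, Complex.norm_exp,
    Complex.add_re, Complex.ofReal_re, Complex.I_mul_re, Complex.ofReal_im, neg_zero, add_zero]

theorem differentiable_gaussian (z : (Fin D → ℝ) × (Fin D → ℝ)) :
    Differentiable ℝ (gaussian ε Γ z) := by
  have hofReal : Differentiable ℝ (fun r : ℝ => (r : ℂ)) := Complex.ofRealCLM.differentiable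
  have hquad : Differentiable ℝ fun x : Fin D → ℝ =>
      -(1 / (2 * ε)) * ((x - z.1) ⬝ᵥ Γ *ᵥ (x - z.1)) := by
    simp only [dotProduct, mulVec, Pi.sub_apply]
    fun_prop
  have hlin : Differentiable ℝ fun x : Fin D → ℝ => (1 / ε) * (z.2 ⬝ᵥ (x - z.1)) := by
    simp only [dotProduct, Pi.sub_apply]
    fun_prop
  exact (((hofReal.comp hquad).add ((hofReal.comp hlin).const_mul _)).cexp).const_mul _

theorem exists_norm_gaussian_le (hε : 0 < ε) (hΓ : Γ.PosDef) (z : (Fin D → ℝ) × (Fin D → ℝ)) :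
    ∃ C b : ℝ, 0 < b ∧
      ∀ x, ‖gaussian ε Γ z x‖ ≤ C * Real.exp (-b * ∑ i, (x - z.1) i ^ 2) := by
  obtain ⟨c, hc, hcoercive⟩ := hΓ.exists_pos_mul_sum_sq_le
  refine ⟨|(Γ.det / (Real.pi ^ D * ε ^ D)) ^ ((1 : ℝ) / 4)|, 1 / (2 * ε) * c, by positivity,
    fun x => (norm_gaussian z x).trans_le ?_⟩
  refine mul_le_mul_of_nonneg_left (Real.exp_le_exp.mpr ?_) (abs_nonneg _)
  rw [neg_mul, neg_mul, neg_le_neg_iff, mul_assoc]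
  exact mul_le_mul_of_nonneg_left (hcoercive _) (by positivity)

theorem exists_norm_gaussian_le_const (hε : 0 < ε) (hΓ : Γ.PosDef)
    (z : (Fin D → ℝ) × (Fin D → ℝ)) : ∃ C : ℝ, ∀ x, ‖gaussian ε Γ z x‖ ≤ C := by
  refine ⟨_, fun x => (norm_gaussian z x).trans_le <|
    mul_le_of_le_one_right (abs_nonneg _) (Real.exp_le_one_iff.mpr ?_)⟩
  have := hΓ.posSemidef.dotProduct_mulVec_nonneg (x - z.1)
  rw [star_trivial] at this
  rw [neg_mul, neg_nonpos]
  positivity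

theorem integrable_gaussian (hε : 0 < ε) (hΓ : Γ.PosDef) (z : (Fin D → ℝ) × (Fin D → ℝ)) :
    Integrable (gaussian ε Γ z) := by
  obtain ⟨C, b, hb, hle⟩ := exists_norm_gaussian_le hε hΓ z
  exact (((integrable_exp_neg_mul_sum_sq hb).comp_sub_right z.1).const_mul C).mono'
    (differentiable_gaussian z).continuous.aestronglyMeasurable (.of_forall hle)

theorem integrable_coord_mul_gaussian (hε : 0 < ε) (hΓ : Γ.PosDef)
    (z : (Fin D → ℝ) × (Fin D → ℝ)) (k : Fin D) :
    Integrable fun x => (((x - z.1) k : ℝ) : ℂ) * gaussian ε Γ z x := by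
  obtain ⟨C, b, hb, hle⟩ := exists_norm_gaussian_le hε hΓ z
  have hcont := (differentiable_gaussian (ε := ε) (Γ := Γ) z).continuous
  refine (((integrable_coord_mul_exp_neg_mul_sum_sq hb k).comp_sub_right z.1).norm.const_mul
    C).mono' (by simp only [Pi.sub_apply]; exact Continuous.aestronglyMeasurable (by fun_prop))
    (.of_forall fun x => ?_)
  rw [norm_mul, norm_mul, Complex.norm_real, mul_left_comm, Real.norm_of_nonneg (Real.exp_nonneg _)]
  exact mul_le_mul_of_nonneg_left (hle x) (norm_nonneg _)

theorem fderiv_gaussian_single (hε : ε ≠ 0) (hΓ : Γ.IsSymm) (z : (Fin D → ℝ) × (Fin D → ℝ))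
    (j : Fin D) (x : Fin D → ℝ) :
    fderiv ℝ (gaussian ε Γ z) x (Pi.single j 1) =
      (Complex.I * (z.2 j : ℂ) - ((Γ *ᵥ (x - z.1)) j : ℝ)) / ε * gaussian ε Γ z x := by
  rw [← (differentiable_gaussian z x).lineDeriv_eq_fderiv]
  refine HasLineDerivAt.lineDeriv ?_
  set u := x - z.1 with hu
  have hshift (t : ℝ) : x + t • Pi.single j 1 - z.1 = u + t • Pi.single j 1 := by
    rw [hu]; abel
  have hquad (t : ℝ) : (u + t • Pi.single j 1) ⬝ᵥ Γ *ᵥ (u + t • Pi.single j 1) =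
      u ⬝ᵥ Γ *ᵥ u + t * (2 * (Γ *ᵥ u) j) + t ^ 2 * Γ j j := by
    have hsymm : u ⬝ᵥ Γ *ᵥ Pi.single j 1 = (Γ *ᵥ u) j := by
      rw [dotProduct_mulVec, ← mulVec_transpose, hΓ.eq, dotProduct_single_one]
    rw [mulVec_add, mulVec_smul, add_dotProduct, dotProduct_add, dotProduct_add,
      dotProduct_smul, smul_dotProduct, smul_dotProduct, dotProduct_smul, hsymm,
      single_one_dotProduct, single_one_dotProduct, mulVec_single_one]
    simp only [smul_eq_mul, col_apply]
    ring
  have hlin (t : ℝ) : z.2 ⬝ᵥ (u + t • Pi.single j 1) = z.2 ⬝ᵥ u + t * z.2 j := by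
    rw [dotProduct_add, dotProduct_smul, dotProduct_single_one, smul_eq_mul]
  have hid : HasDerivAt (fun t : ℝ => t) 1 0 := hasDerivAt_id 0
  have hre : HasDerivAt (fun t : ℝ => -(1 / (2 * ε)) *
      (u ⬝ᵥ Γ *ᵥ u + t * (2 * (Γ *ᵥ u) j) + t ^ 2 * Γ j j)) (-((Γ *ᵥ u) j / ε)) 0 := by
    have h := (((hid.mul_const (2 * (Γ *ᵥ u) j)).const_add (u ⬝ᵥ Γ *ᵥ u)).add
      ((hid.pow 2).mul_const (Γ j j))).const_mul (-(1 / (2 * ε)))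
    refine h.congr_deriv ?_
    field_simp
    simp
  have him : HasDerivAt (fun t : ℝ => (1 / ε) * (z.2 ⬝ᵥ u + t * z.2 j)) (z.2 j / ε) 0 := by
    have h := ((hid.mul_const (z.2 j)).const_add (z.2 ⬝ᵥ u)).const_mul (1 / ε)
    refine h.congr_deriv ?_
    ring
  have h := ((hre.ofReal_comp.add (him.ofReal_comp.const_mul Complex.I)).cexp).const_mul
    (((Γ.det / (Real.pi ^ D * ε ^ D)) ^ ((1 : ℝ) / 4) : ℝ) : ℂ)
  unfold HasLineDerivAt
  simp only [gaussian, hshift, hquad, hlin]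
  refine h.congr_deriv ?_
  simp only [Pi.add_apply, zero_mul, add_zero, ne_eq, OfNat.ofNat_ne_zero, not_false_eq_true,
    zero_pow, ← hu]
  push_cast
  ring

theorem integrable_fderiv_gaussian_single (hε : 0 < ε) (hΓ : Γ.PosDef)
    (z : (Fin D → ℝ) × (Fin D → ℝ)) (j : Fin D) :
    Integrable fun x => fderiv ℝ (gaussian ε Γ z) x (Pi.single j 1) := by
  have hsum : Integrable fun x => ∑ k, ((Γ j k : ℝ) : ℂ) *
      ((((x - z.1) k : ℝ) : ℂ) * gaussian ε Γ z x) :=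
    integrable_finsetSum _ fun k _ => (integrable_coord_mul_gaussian hε hΓ z k).const_mul _
  refine ((((integrable_gaussian hε hΓ z).const_mul (Complex.I * (z.2 j : ℂ))).sub
    hsum).div_const (ε : ℂ)).congr (.of_forall fun x => ?_)
  have hsymm : Γ.IsSymm := by simpa using hΓ.isHermitian
  simp only [Pi.sub_apply, fderiv_gaussian_single hε.ne' hsymm, ← mul_assoc, ← Finset.sum_mul]
  simp only [mulVec, dotProduct, Pi.sub_apply]
  push_cast
  ring

theorem fderiv_conj_apply {E : Type*} [NormedAddCommGroup E] [NormedSpace ℝ E] (f : E → ℂ)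
    (x v : E) :
    fderiv ℝ (fun x => (starRingEnd ℂ) (f x)) x v = (starRingEnd ℂ) (fderiv ℝ f x v) := by
  have h := Complex.conjCLE.comp_fderiv (f := f) (x := x)
  exact congrArg (fun L => L v) h

theorem integrable_conj_gaussian_mul (hε : 0 < ε) (hΓ : Γ.PosDef)
    (y : (Fin D → ℝ) × (Fin D → ℝ)) {f : (Fin D → ℝ) → ℂ} (hf : Integrable f) :
    Integrable fun x => (starRingEnd ℂ) (gaussian ε Γ y x) * f x := by
  obtain ⟨C, hC⟩ := exists_norm_gaussian_le_const hε hΓ y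
  have hcont := (differentiable_gaussian (ε := ε) (Γ := Γ) y).continuous
  refine hf.bdd_mul (c := C)
    (Complex.continuous_conj.comp hcont).aestronglyMeasurable (.of_forall fun x => ?_)
  rw [RCLike.norm_conj]
  exact hC x

theorem integral_conj_gaussian_mul_fderiv (hε : 0 < ε) (hΓ : Γ.PosDef) (j : Fin D)
    (y z : (Fin D → ℝ) × (Fin D → ℝ)) :
    ∫ x, (starRingEnd ℂ) (gaussian ε Γ y x) * fderiv ℝ (gaussian ε Γ z) x (Pi.single j 1) =
      -∫ x, (starRingEnd ℂ) (fderiv ℝ (gaussian ε Γ y) x (Pi.single j 1)) *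
        gaussian ε Γ z x := by
  simp only [← fderiv_conj_apply]
  refine integral_mul_fderiv_eq_neg_fderiv_mul_of_integrable ?_
    (integrable_conj_gaussian_mul hε hΓ y (integrable_fderiv_gaussian_single hε hΓ z j))
    (integrable_conj_gaussian_mul hε hΓ y (integrable_gaussian hε hΓ z))
    (fun x _ => Complex.conjCLE.differentiable.comp (differentiable_gaussian y) x)
    (fun x _ => differentiable_gaussian z x)
  obtain ⟨C, hC⟩ := exists_norm_gaussian_le_const hε hΓ z
  simp only [fderiv_conj_apply]
  exact ((Complex.conjCLE.toContinuousLinearMap.integrable_comp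
    (integrable_fderiv_gaussian_single hε hΓ y j))).mul_bdd
    (differentiable_gaussian z).continuous.aestronglyMeasurable (.of_forall hC)

end Gaussian

theorem stmt12 (D : ℕ) (hD : 1 ≤ D) (ε : ℝ) (hε : 0 < ε)
    (Γ : Matrix (Fin D) (Fin D) ℝ) (hΓ : Γ.PosDef) (j : Fin D)
    (y z : (Fin D → ℝ) × (Fin D → ℝ)) :
    Integrable (fun x : Fin D → ℝ =>
      (starRingEnd ℂ) (gaussian ε Γ y x) *
        (-Complex.I * (ε : ℂ) *
          fderiv ℝ (gaussian ε Γ z) x (Pi.single j 1))) ∧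
    (∫ x : Fin D → ℝ,
        (starRingEnd ℂ) (gaussian ε Γ y x) *
          (-Complex.I * (ε : ℂ) *
            fderiv ℝ (gaussian ε Γ z) x (Pi.single j 1))) =
      (1 / 2) * (((y.2 j + z.2 j : ℝ) : ℂ) +
          Complex.I * ((Γ.mulVec (y.1 - z.1) j : ℝ) : ℂ)) *
        ∫ x : Fin D → ℝ, (starRingEnd ℂ) (gaussian ε Γ y x) * gaussian ε Γ z x := by
  have hsymm : Γ.IsSymm := by simpa using hΓ.isHermitian
  have hint := integrable_conj_gaussian_mul hε hΓ y
    ((integrable_fderiv_gaussian_single hε hΓ z j).const_mul (-Complex.I * (ε : ℂ)))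
  refine ⟨hint, ?_⟩
  have hparts := integral_conj_gaussian_mul_fderiv hε hΓ j y z
  have hoverlap := integrable_conj_gaussian_mul hε hΓ y (integrable_gaussian hε hΓ z)
  have hε' : (ε : ℂ) ≠ 0 := by exact_mod_cast hε.ne'
  set K : ℂ := ((y.2 j + z.2 j : ℝ) : ℂ) + Complex.I * ((Γ.mulVec (y.1 - z.1) j : ℝ) : ℂ) with hK
  have hpoint (x : Fin D → ℝ) :
      (starRingEnd ℂ) (fderiv ℝ (gaussian ε Γ y) x (Pi.single j 1)) * gaussian ε Γ z x =
      -(K * Complex.I / ε) * ((starRingEnd ℂ) (gaussian ε Γ y x) * gaussian ε Γ z x) +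
      (starRingEnd ℂ) (gaussian ε Γ y x) * fderiv ℝ (gaussian ε Γ z) x (Pi.single j 1) := by
    rw [fderiv_gaussian_single hε.ne' hsymm, fderiv_gaussian_single hε.ne' hsymm, hK]
    simp only [map_mul, map_div₀, map_sub, Complex.conj_I, Complex.conj_ofReal, mulVec_sub,
      Pi.sub_apply]
    push_cast
    field_simp
    ring_nf
    simp only [Complex.I_sq]
    ring
  rw [integral_congr_ae (.of_forall hpoint), integral_add (hoverlap.const_mul _)
    (integrable_conj_gaussian_mul hε hΓ y (integrable_fderiv_gaussian_single hε hΓ z j)),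
    integral_const_mul] at hparts
  simp only [mul_left_comm _ (-Complex.I * (ε : ℂ)), integral_const_mul]
  set A := ∫ x, (starRingEnd ℂ) (gaussian ε Γ y x) *
    fderiv ℝ (gaussian ε Γ z) x (Pi.single j 1)
  have hA : A = 1 / 2 * (K * Complex.I / ε) *
      ∫ x, (starRingEnd ℂ) (gaussian ε Γ y x) * gaussian ε Γ z x := by
    linear_combination (1 / 2 : ℂ) * hparts
  rw [hA]
  field_simp
  simp
end

section
/- (Normalization and variance of the optimal sampling approach for the identity operator.) Let D ≥ 1, ε > 0, Γ ∈ ℝ^{D×D} real symmetric positive definite, z₀ ∈ ℝ^{2D}, and Σ₀ = diag(Γ, Γ⁻¹). Then κ_opt := (2πε)^{-2D} ∫_{ℝ^{2D}×ℝ^{2D}} |⟨g_{z₀}, g_y⟩| · |⟨g_z, g_{z₀}⟩| · |⟨g_y, g_z⟩| d(y,z) = (2πε)^{-2D} ∫_{ℝ^{2D}×ℝ^{2D}} exp( −(1/(4ε))[ (y−z₀)ᵀΣ₀(y−z₀) + (z−z₀)ᵀΣ₀(z−z₀) + (y−z)ᵀΣ₀(y−z) ] ) d(y,z) = (4/3)^D.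 Consequently, the initial-time variance of the optimally sampled Monte Carlo estimator for the identity operator equals κ_opt² − 1 = (16/9)^D − 1. -/
open MeasureTheory Matrix

/-- The `L²` overlap `⟨g_y , g_z⟩` of two Gaussian wavepackets. -/
noncomputable def overlap {D : ℕ} (ε : ℝ) (Γ : Matrix (Fin D) (Fin D) ℝ)
    (y z : (Fin D → ℝ) × (Fin D → ℝ)) : ℂ :=
  ∫ x : Fin D → ℝ, (starRingEnd ℂ) (gaussian ε Γ y x) * gaussian ε Γ z x

/-- The quadratic form `w ↦ wᵀ Σ₀ w` on the phase space, where
`Σ₀ = diag(Γ, Γ⁻¹)` is the block-diagonal matrix with blocks `Γ` and `Γ⁻¹`. -/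
noncomputable def quadSigma {D : ℕ} (Γ : Matrix (Fin D) (Fin D) ℝ)
    (w : (Fin D → ℝ) × (Fin D → ℝ)) : ℝ :=
  Sum.elim w.1 w.2 ⬝ᵥ (Matrix.fromBlocks Γ 0 0 Γ⁻¹).mulVec (Sum.elim w.1 w.2)

/-- Linear change of variables by an invertible matrix. -/
lemma integral_comp_mulVec {ι E : Type*} [Fintype ι] [DecidableEq ι] [NormedAddCommGroup E]
    [NormedSpace ℝ E] {M : Matrix ι ι ℝ} (hM : M.det ≠ 0) (f : (ι → ℝ) → E) :
    ∫ x, f (M *ᵥ x) = |M.det|⁻¹ • ∫ x, f x := by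
  have hemb : MeasurableEmbedding (toLin' M) := by
    have hinj : Function.Injective (toLin' M) := by
      intro x y hxy
      simp only [toLin'_apply] at hxy
      exact Matrix.mulVec_injective_of_isUnit
        ((Matrix.isUnit_iff_isUnit_det M).2 (isUnit_iff_ne_zero.2 hM)) hxy
    exact (LinearMap.continuous_of_finiteDimensional (toLin' M)).measurableEmbedding hinj
  have h := hemb.integral_map (μ := volume) f
  rw [Real.map_matrix_volume_pi_eq_smul_volume_pi hM, integral_smul_measure,
    ENNReal.toReal_ofReal (abs_nonneg _), abs_inv] at h
  simpa only [toLin'_apply] using h.symm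

/-- The Fourier transform of the Gaussian `exp (-b xᵀ Γ x)`. -/
lemma integral_cexp_neg_mul_quadratic_add {ι : Type*} [Fintype ι] [DecidableEq ι]
    {Γ : Matrix ι ι ℝ} (hΓ : Γ.PosDef) {b : ℝ} (hb : 0 < b) (c : ι → ℝ) :
    ∫ x : ι → ℝ, Complex.exp (((-b * (x ⬝ᵥ Γ *ᵥ x) : ℝ) : ℂ) + Complex.I * ((c ⬝ᵥ x : ℝ) : ℂ)) =
      (((Real.pi / b) ^ ((Fintype.card ι : ℝ) / 2) * (√Γ.det)⁻¹ *
        Real.exp (-(1 / (4 * b)) * (c ⬝ᵥ Γ⁻¹ *ᵥ c)) : ℝ) : ℂ) := by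
  obtain ⟨B, hB, rfl⟩ : ∃ B : Matrix ι ι ℝ, IsUnit B ∧ Γ = Bᵀ * B := by
    open scoped MatrixOrder Matrix.Norms.L2Operator in
    obtain ⟨B, hB, h⟩ := CStarAlgebra.isStrictlyPositive_iff_eq_star_mul_self.mp
      hΓ.isStrictlyPositive
    exact ⟨B, hB, by simpa [star_eq_conjTranspose, conjTranspose_eq_transpose_of_trivial] using h⟩
  have hdet : IsUnit B.det := (Matrix.isUnit_iff_isUnit_det B).1 hB
  set d : ι → ℝ := B⁻¹ᵀ *ᵥ c with hd
  have hquad (x : ι → ℝ) : x ⬝ᵥ (Bᵀ * B) *ᵥ x = ∑ i, (B *ᵥ x) i ^ 2 := by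
    rw [← mulVec_mulVec, dotProduct_mulVec, vecMul_transpose]
    simp [dotProduct, sq]
  have hlin (x : ι → ℝ) : c ⬝ᵥ x = d ⬝ᵥ B *ᵥ x := by
    rw [hd, dotProduct_mulVec, mulVec_transpose, vecMul_vecMul, nonsing_inv_mul _ hdet, vecMul_one]
  have hdual : c ⬝ᵥ (Bᵀ * B)⁻¹ *ᵥ c = ∑ i, d i ^ 2 := by
    rw [Matrix.mul_inv_rev, ← mulVec_mulVec, dotProduct_mulVec, ← transpose_nonsing_inv,
      ← mulVec_transpose]
    simp [dotProduct, sq, hd]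
  have hsqrt : √(Bᵀ * B).det = |B.det| := by
    rw [det_mul, det_transpose, Real.sqrt_mul_self_eq_abs]
  have hcov := integral_comp_mulVec hdet.ne_zero (fun v : ι → ℝ ↦
    Complex.exp (-(b : ℂ) * ∑ i, (v i : ℂ) ^ 2 + ∑ i, (Complex.I * d i) * v i))
  rw [GaussianFourier.integral_cexp_neg_mul_sum_add (by simpa using hb)] at hcov
  have hfun (x : ι → ℝ) :
      ((-b * (x ⬝ᵥ (Bᵀ * B) *ᵥ x) : ℝ) : ℂ) + Complex.I * ((c ⬝ᵥ x : ℝ) : ℂ) =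
      -(b : ℂ) * ∑ i, ((B *ᵥ x) i : ℂ) ^ 2 + ∑ i, (Complex.I * d i) * (B *ᵥ x) i := by
    rw [hquad, hlin, dotProduct]
    push_cast
    simp only [Finset.mul_sum, mul_assoc]
  simp_rw [hfun]
  rw [hcov, hsqrt, hdual]
  have hexp : (∑ i, (Complex.I * (d i : ℂ)) ^ 2) / (4 * (b : ℂ)) =
      ((-(1 / (4 * b)) * ∑ i, d i ^ 2 : ℝ) : ℂ) := by
    push_cast
    simp only [mul_pow, Complex.I_sq, ← Finset.mul_sum]
    ring
  rw [hexp, Complex.real_smul]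
  push_cast [Complex.ofReal_cpow (div_pos Real.pi_pos hb).le]
  ring

lemma integral_exp_neg_mul_quadratic {ι : Type*} [Fintype ι] [DecidableEq ι]
    {Γ : Matrix ι ι ℝ} (hΓ : Γ.PosDef) {b : ℝ} (hb : 0 < b) :
    ∫ x : ι → ℝ, Real.exp (-b * (x ⬝ᵥ Γ *ᵥ x)) =
      (Real.pi / b) ^ ((Fintype.card ι : ℝ) / 2) * (√Γ.det)⁻¹ := by
  have h := integral_cexp_neg_mul_quadratic_add hΓ hb 0
  simp only [zero_dotProduct, Complex.ofReal_zero, mul_zero, add_zero, Real.exp_zero, mul_one,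
    ← Complex.ofReal_exp] at h
  rw [integral_complex_ofReal] at h
  exact_mod_cast h

lemma quadSigma_eq {D : ℕ} (Γ : Matrix (Fin D) (Fin D) ℝ) (w : (Fin D → ℝ) × (Fin D → ℝ)) :
    quadSigma Γ w = w.1 ⬝ᵥ Γ *ᵥ w.1 + w.2 ⬝ᵥ Γ⁻¹ *ᵥ w.2 := by
  simp [quadSigma, fromBlocks_mulVec, sumElim_dotProduct_sumElim]

lemma integral_exp_neg_mul_quadSigma {D : ℕ} {Γ : Matrix (Fin D) (Fin D) ℝ} (hΓ : Γ.PosDef)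
    {b : ℝ} (hb : 0 < b) :
    ∫ w : (Fin D → ℝ) × (Fin D → ℝ), Real.exp (-b * quadSigma Γ w) = (Real.pi / b) ^ D := by
  simp_rw [quadSigma_eq, mul_add, Real.exp_add]
  rw [Measure.volume_eq_prod, integral_prod_mul (fun q : Fin D → ℝ ↦ Real.exp (-b * (q ⬝ᵥ Γ *ᵥ q)))
    (fun p : Fin D → ℝ ↦ Real.exp (-b * (p ⬝ᵥ Γ⁻¹ *ᵥ p))), integral_exp_neg_mul_quadratic hΓ hb,
    integral_exp_neg_mul_quadratic hΓ.inv hb, det_nonsing_inv, Ring.inverse_eq_inv', Real.sqrt_inv,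
    inv_inv, mul_mul_mul_comm, inv_mul_cancel₀ (Real.sqrt_pos.2 hΓ.det_pos).ne', mul_one,
    ← Real.rpow_add (div_pos Real.pi_pos hb), add_halves, Fintype.card_fin, Real.rpow_natCast]

lemma dotProduct_mulVec_comm_of_isSymm {ι R : Type*} [Fintype ι] [CommSemiring R]
    {A : Matrix ι ι R} (hA : A.IsSymm) (x y : ι → R) : x ⬝ᵥ A *ᵥ y = y ⬝ᵥ A *ᵥ x := by
  rw [dotProduct_mulVec, ← mulVec_transpose, hA.eq, dotProduct_comm]

lemma conj_gaussian_mul_gaussian {D : ℕ} (ε : ℝ) {Γ : Matrix (Fin D) (Fin D) ℝ} (hΓ : Γ.IsSymm)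
    (y z : (Fin D → ℝ) × (Fin D → ℝ)) (u : Fin D → ℝ) :
    (starRingEnd ℂ) (gaussian ε Γ y (u + (1 / 2 : ℝ) • (y.1 + z.1))) *
        gaussian ε Γ z (u + (1 / 2 : ℝ) • (y.1 + z.1)) =
      ((((Γ.det / (Real.pi ^ D * ε ^ D)) ^ ((1 : ℝ) / 4)) ^ 2 *
          Real.exp (-(1 / (4 * ε)) * ((y.1 - z.1) ⬝ᵥ Γ *ᵥ (y.1 - z.1))) : ℝ) : ℂ) *
        Complex.exp (((-(1 / (2 * ε)) * ((y.2 + z.2) ⬝ᵥ (z.1 - y.1)) : ℝ) : ℂ) * Complex.I) *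
        Complex.exp (((-(1 / ε) * (u ⬝ᵥ Γ *ᵥ u) : ℝ) : ℂ) +
          Complex.I * ((((1 / ε) • (z.2 - y.2)) ⬝ᵥ u : ℝ) : ℂ)) := by
  set δ : Fin D → ℝ := (1 / 2 : ℝ) • (z.1 - y.1) with hδ
  have hy : u + (1 / 2 : ℝ) • (y.1 + z.1) - y.1 = u + δ := by
    ext i; simp [hδ]; ring
  have hz : u + (1 / 2 : ℝ) • (y.1 + z.1) - z.1 = u - δ := by
    ext i; simp [hδ]; ring
  have hyz : y.1 - z.1 = (-2 : ℝ) • δ := by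
    ext i; simp [hδ]
  have hzy : z.1 - y.1 = (2 : ℝ) • δ := by
    ext i; simp [hδ]
  have hcomm := dotProduct_mulVec_comm_of_isSymm hΓ u δ
  rw [gaussian, gaussian, hy, hz, hyz, hzy, map_mul, Complex.conj_ofReal, ← Complex.exp_conj,
    mul_mul_mul_comm, ← Complex.exp_add, ← Complex.ofReal_mul, ← sq,
    Complex.ofReal_mul (_ ^ 2), mul_assoc, mul_assoc, Complex.ofReal_exp, ← Complex.exp_add,
    ← Complex.exp_add]
  congr 2
  simp only [map_add, map_mul, Complex.conj_ofReal, Complex.conj_I, mulVec_add, mulVec_sub,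
    mulVec_smul, add_dotProduct, sub_dotProduct, dotProduct_add, dotProduct_sub, smul_dotProduct,
    dotProduct_smul, smul_eq_mul, hcomm]
  push_cast
  ring

lemma norm_overlap {D : ℕ} {ε : ℝ} (hε : 0 < ε) {Γ : Matrix (Fin D) (Fin D) ℝ} (hΓ : Γ.PosDef)
    (y z : (Fin D → ℝ) × (Fin D → ℝ)) :
    ‖overlap ε Γ y z‖ = Real.exp (-(1 / (4 * ε)) * quadSigma Γ (y - z)) := by
  have hsymm : Γ.IsSymm := by simpa using hΓ.isHermitian
  have hnorm : ((Γ.det / (Real.pi ^ D * ε ^ D)) ^ ((1 : ℝ) / 4)) ^ 2 *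
      ((Real.pi / (1 / ε)) ^ ((D : ℝ) / 2) * (√Γ.det)⁻¹) = 1 := by
    have hd := hΓ.det_pos
    have hπε : 0 < Real.pi * ε := by positivity
    rw [← mul_pow, ← Real.rpow_natCast, ← Real.rpow_mul (by positivity), one_div (ε : ℝ),
      div_inv_eq_mul]
    have h1 : (1 : ℝ) / 4 * (2 : ℕ) = 1 / 2 := by norm_num
    rw [h1, ← Real.sqrt_eq_rpow, Real.sqrt_div hd.le, div_eq_mul_one_div (D : ℝ),
      Real.rpow_mul hπε.le, Real.rpow_natCast, ← Real.sqrt_eq_rpow]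
    have h2 : √Γ.det ≠ 0 := (Real.sqrt_pos.2 hd).ne'
    have h3 : √((Real.pi * ε) ^ D) ≠ 0 := (Real.sqrt_pos.2 (pow_pos hπε D)).ne'
    field_simp
  have hflip : (z.2 - y.2) ⬝ᵥ Γ⁻¹ *ᵥ (z.2 - y.2) = (y.2 - z.2) ⬝ᵥ Γ⁻¹ *ᵥ (y.2 - z.2) := by
    rw [← neg_sub y.2 z.2, mulVec_neg, neg_dotProduct_neg]
  rw [overlap, ← integral_add_right_eq_self _ ((1 / 2 : ℝ) • (y.1 + z.1))]
  simp_rw [conj_gaussian_mul_gaussian ε hsymm]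
  rw [integral_const_mul, integral_cexp_neg_mul_quadratic_add hΓ (one_div_pos.2 hε), norm_mul,
    norm_mul, Complex.norm_exp_ofReal_mul_I, mul_one, Complex.norm_real, Complex.norm_real,
    Real.norm_of_nonneg (by have := hΓ.det_pos; positivity), Real.norm_of_nonneg (by positivity),
    Fintype.card_fin, mul_mul_mul_comm, hnorm, one_mul, ← Real.exp_add, quadSigma_eq,
    Prod.fst_sub, Prod.snd_sub, ← hflip]
  congr 1
  simp only [smul_dotProduct, mulVec_smul, dotProduct_smul, smul_eq_mul]
  field_simp
  ring

lemma quadSigma_neg {D : ℕ} (Γ : Matrix (Fin D) (Fin D) ℝ) (w : (Fin D → ℝ) × (Fin D → ℝ)) :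
    quadSigma Γ (-w) = quadSigma Γ w := by
  simp [quadSigma_eq, mulVec_neg]

lemma continuous_quadSigma {D : ℕ} (Γ : Matrix (Fin D) (Fin D) ℝ) :
    Continuous (quadSigma Γ) := by
  simp_rw [funext (quadSigma_eq Γ)]
  fun_prop

/-- Completing the square in the second variable. -/
lemma quadSigma_add_add_sub {D : ℕ} {Γ : Matrix (Fin D) (Fin D) ℝ} (hΓ : Γ.IsSymm)
    (y z : (Fin D → ℝ) × (Fin D → ℝ)) :
    quadSigma Γ y + quadSigma Γ z + quadSigma Γ (y - z) =
      3 / 2 * quadSigma Γ y + 2 * quadSigma Γ (z - (1 / 2 : ℝ) • y) := by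
  have h1 := dotProduct_mulVec_comm_of_isSymm hΓ y.1 z.1
  have h2 := dotProduct_mulVec_comm_of_isSymm (A := Γ⁻¹)
    (by rw [IsSymm, transpose_nonsing_inv, hΓ.eq]) y.2 z.2
  simp only [quadSigma_eq, Prod.fst_sub, Prod.snd_sub, Prod.smul_fst, Prod.smul_snd, mulVec_sub,
    mulVec_smul, sub_dotProduct, dotProduct_sub, smul_dotProduct, dotProduct_smul, smul_eq_mul,
    h1, h2]
  ring

lemma integral_exp_neg_mul_triple_quadSigma {D : ℕ} {ε : ℝ} (hε : 0 < ε)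
    {Γ : Matrix (Fin D) (Fin D) ℝ} (hΓ : Γ.PosDef) (z₀ : (Fin D → ℝ) × (Fin D → ℝ)) :
    ∫ w : ((Fin D → ℝ) × (Fin D → ℝ)) × ((Fin D → ℝ) × (Fin D → ℝ)),
        Real.exp (-(1 / (4 * ε)) * (quadSigma Γ (w.1 - z₀) +
          quadSigma Γ (w.2 - z₀) + quadSigma Γ (w.1 - w.2))) =
      (2 * Real.pi * ε) ^ (2 * D) * (4 / 3) ^ D := by
  have hsymm : Γ.IsSymm := by simpa using hΓ.isHermitian
  let F : (Fin D → ℝ) × (Fin D → ℝ) → ℝ := fun y ↦ Real.exp (-(3 / (8 * ε)) * quadSigma Γ y)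
  let G : (Fin D → ℝ) × (Fin D → ℝ) → ℝ := fun z ↦ Real.exp (-(1 / (2 * ε)) * quadSigma Γ z)
  have hF : Continuous F := by have := continuous_quadSigma Γ; fun_prop
  have hG : Continuous G := by have := continuous_quadSigma Γ; fun_prop
  have : (volume : Measure ((Fin D → ℝ) × (Fin D → ℝ))).IsAddRightInvariant := by
    rw [Measure.volume_eq_prod]
    infer_instance
  have hshear : MeasurePreserving
      (fun w : ((Fin D → ℝ) × (Fin D → ℝ)) × ((Fin D → ℝ) × (Fin D → ℝ)) ↦
        (w.1, w.2 - (1 / 2 : ℝ) • w.1)) (volume.prod volume) (volume.prod volume) :=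
    (MeasurePreserving.id volume).skew_product (g := fun y z ↦ z - (1 / 2 : ℝ) • y)
      (by unfold Function.uncurry; fun_prop)
      (.of_forall fun y ↦ (measurePreserving_sub_right volume _).map_eq)
  have : ((volume : Measure ((Fin D → ℝ) × (Fin D → ℝ))).prod
      (volume : Measure ((Fin D → ℝ) × (Fin D → ℝ)))).IsAddRightInvariant :=
    Measure.prod.instIsAddRightInvariant
  rw [Measure.volume_eq_prod, ← integral_add_right_eq_self _ ((z₀, z₀) : _ × _)]
  have hpt (w : ((Fin D → ℝ) × (Fin D → ℝ)) × ((Fin D → ℝ) × (Fin D → ℝ))) :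
      Real.exp (-(1 / (4 * ε)) * (quadSigma Γ ((w + (z₀, z₀)).1 - z₀) +
        quadSigma Γ ((w + (z₀, z₀)).2 - z₀) + quadSigma Γ ((w + (z₀, z₀)).1 - (w + (z₀, z₀)).2))) =
      F w.1 * G (w.2 - (1 / 2 : ℝ) • w.1) := by
    simp only [F, G, Prod.fst_add, Prod.snd_add, add_sub_cancel_right, add_sub_add_right_eq_sub,
      ← Real.exp_add, quadSigma_add_add_sub hsymm]
    congr 1
    ring
  simp_rw [hpt]
  have hmap := integral_map hshear.aemeasurable
    (f := fun w : ((Fin D → ℝ) × (Fin D → ℝ)) × ((Fin D → ℝ) × (Fin D → ℝ)) ↦ F w.1 * G w.2)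
    (by fun_prop)
  rw [hshear.map_eq, integral_prod_mul] at hmap
  rw [← hmap]
  simp only [F, G]
  rw [integral_exp_neg_mul_quadSigma hΓ (by positivity),
    integral_exp_neg_mul_quadSigma hΓ (by positivity), pow_mul, ← mul_pow, ← mul_pow]
  congr 1
  field_simp
  ring

theorem stmt16 (D : ℕ) (hD : 1 ≤ D) (ε : ℝ) (hε : 0 < ε)
    (Γ : Matrix (Fin D) (Fin D) ℝ) (hΓ : Γ.PosDef)
    (z₀ : (Fin D → ℝ) × (Fin D → ℝ)) :
    -- the normalization constant κ_opt of the optimal density equals (4/3)^D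
    ((2 * Real.pi * ε) ^ (2 * D))⁻¹ *
        (∫ w : ((Fin D → ℝ) × (Fin D → ℝ)) × ((Fin D → ℝ) × (Fin D → ℝ)),
          ‖overlap ε Γ z₀ w.1‖ * ‖overlap ε Γ w.2 z₀‖ * ‖overlap ε Γ w.1 w.2‖) =
      ((2 * Real.pi * ε) ^ (2 * D))⁻¹ *
        (∫ w : ((Fin D → ℝ) × (Fin D → ℝ)) × ((Fin D → ℝ) × (Fin D → ℝ)),
          Real.exp (-(1 / (4 * ε)) * (quadSigma Γ (w.1 - z₀) +
            quadSigma Γ (w.2 - z₀) + quadSigma Γ (w.1 - w.2)))) ∧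
    ((2 * Real.pi * ε) ^ (2 * D))⁻¹ *
        (∫ w : ((Fin D → ℝ) × (Fin D → ℝ)) × ((Fin D → ℝ) × (Fin D → ℝ)),
          Real.exp (-(1 / (4 * ε)) * (quadSigma Γ (w.1 - z₀) +
            quadSigma Γ (w.2 - z₀) + quadSigma Γ (w.1 - w.2)))) = (4 / 3) ^ D ∧
    -- consequently the initial-time variance for the identity equals (16/9)^D − 1
    (((2 * Real.pi * ε) ^ (2 * D))⁻¹ *
        (∫ w : ((Fin D → ℝ) × (Fin D → ℝ)) × ((Fin D → ℝ) × (Fin D → ℝ)),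
          ‖overlap ε Γ z₀ w.1‖ * ‖overlap ε Γ w.2 z₀‖ * ‖overlap ε Γ w.1 w.2‖)) ^ 2 - 1 =
      (16 / 9 : ℝ) ^ D - 1 := by
  have hκ := integral_exp_neg_mul_triple_quadSigma hε hΓ z₀
  have hoverlap (w : ((Fin D → ℝ) × (Fin D → ℝ)) × ((Fin D → ℝ) × (Fin D → ℝ))) :
      ‖overlap ε Γ z₀ w.1‖ * ‖overlap ε Γ w.2 z₀‖ * ‖overlap ε Γ w.1 w.2‖ =
        Real.exp (-(1 / (4 * ε)) * (quadSigma Γ (w.1 - z₀) +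
          quadSigma Γ (w.2 - z₀) + quadSigma Γ (w.1 - w.2))) := by
    rw [norm_overlap hε hΓ, norm_overlap hε hΓ, norm_overlap hε hΓ, ← neg_sub w.1 z₀,
      quadSigma_neg, ← Real.exp_add, ← Real.exp_add, mul_add, mul_add]
  have hpos : (2 * Real.pi * ε) ^ (2 * D) ≠ 0 := by positivity
  simp_rw [hoverlap]
  rw [hκ, inv_mul_cancel_left₀ hpos, ← pow_mul, mul_comm D 2, pow_mul]
  norm_num
end
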